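/- Let (W,S) be a Coxeter system of finite rank and let C be a parabolic double coset. Define M_L(C) := ⋃ I and M_R(C) := ⋃ J, the unions taken over all triples (I, w, J) with I, J ⊆ S, w ∈ W, and C = W_I w W_J. Then: (a) for any w ∈ C one has C = W_{M_L(C)} w W_{M_R(C)}, and this is the largest presentation in the sense that every presentation C = W_I w' W_J satisfies I ⊆ M_L(C) and J ⊆ M_R(C); and (b) M_L(C) = { s ∈ S : s x ∈ C for all x ∈ C } and M_R(C) = { s ∈ S : x s ∈ C for all x ∈ C }. -/

import Mathlib

open CoxeterSystem

variable {B : Type*} {W : Type*} [Group W]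

/-- The standard parabolic subgroup `W_I` of a Coxeter system, generated by the
simple reflections indexed by `I`. -/
def CoxeterSystem.parabolic {M : CoxeterMatrix B} (cs : CoxeterSystem M W) (I : Set B) :
    Subgroup W :=
  Subgroup.closure (cs.simple '' I)

/-- The parabolic double coset `W_I w W_J`. -/
def CoxeterSystem.doubleCoset {M : CoxeterMatrix B} (cs : CoxeterSystem M W) (I : Set B)
    (w : W) (J : Set B) : Set W :=
  {x | ∃ u ∈ cs.parabolic I, ∃ v ∈ cs.parabolic J, x = u * w * v}

namespace CoxeterSystem

variable {M : CoxeterMatrix B} (cs : CoxeterSystem M W)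

theorem simple_mem_parabolic {I : Set B} {i : B} (hi : i ∈ I) :
    cs.simple i ∈ cs.parabolic I :=
  Subgroup.subset_closure ⟨i, hi, rfl⟩

theorem parabolic_mono {I J : Set B} (h : I ⊆ J) : cs.parabolic I ≤ cs.parabolic J :=
  Subgroup.closure_mono (Set.image_mono h)

theorem simple_mul_mem_doubleCoset {I J : Set B} {w x : W} {i : B} (hi : i ∈ I)
    (hx : x ∈ cs.doubleCoset I w J) : cs.simple i * x ∈ cs.doubleCoset I w J := by
  obtain ⟨u, hu, v, hv, rfl⟩ := hx
  exact ⟨cs.simple i * u, mul_mem (cs.simple_mem_parabolic hi) hu, v, hv, by group⟩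

theorem mul_simple_mem_doubleCoset {I J : Set B} {w x : W} {j : B} (hj : j ∈ J)
    (hx : x ∈ cs.doubleCoset I w J) : x * cs.simple j ∈ cs.doubleCoset I w J := by
  obtain ⟨u, hu, v, hv, rfl⟩ := hx
  exact ⟨u, hu, v * cs.simple j, mul_mem hv (cs.simple_mem_parabolic hj), by group⟩

theorem doubleCoset_mono {I I' J J' : Set B} (hI : I ⊆ I') (hJ : J ⊆ J') (w : W) :
    cs.doubleCoset I w J ⊆ cs.doubleCoset I' w J' := by
  rintro x ⟨u, hu, v, hv, rfl⟩
  exact ⟨u, cs.parabolic_mono hI hu, v, cs.parabolic_mono hJ hv, rfl⟩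

theorem mem_doubleCoset_self (I : Set B) (w : W) (J : Set B) : w ∈ cs.doubleCoset I w J :=
  ⟨1, one_mem _, 1, one_mem _, by group⟩

theorem doubleCoset_subset_of_mem {I J : Set B} {w x : W} (hx : x ∈ cs.doubleCoset I w J) :
    cs.doubleCoset I w J ⊆ cs.doubleCoset I x J := by
  obtain ⟨u, hu, v, hv, rfl⟩ := hx
  rintro _ ⟨u', hu', v', hv', rfl⟩
  exact ⟨u' * u⁻¹, mul_mem hu' (inv_mem hu), v⁻¹ * v', mul_mem (inv_mem hv) hv', by group⟩

theorem mul_mem_iff_of_mem_parabolic {I : Set B} {C : Set W}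
    (h : ∀ i ∈ I, ∀ x ∈ C, cs.simple i * x ∈ C) {u : W} (hu : u ∈ cs.parabolic I) (x : W) :
    u * x ∈ C ↔ x ∈ C := by
  induction hu using Subgroup.closure_induction generalizing x with
  | mem _ hs =>
    obtain ⟨i, hi, rfl⟩ := hs
    exact ⟨fun hx => by simpa using h i hi _ hx, h i hi x⟩
  | one => rw [one_mul]
  | mul a b _ _ iha ihb => rw [mul_assoc, iha, ihb]
  | inv a _ iha => rw [← iha, mul_inv_cancel_left]

theorem mul_mem_iff_of_mem_parabolic_right {J : Set B} {C : Set W}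
    (h : ∀ j ∈ J, ∀ x ∈ C, x * cs.simple j ∈ C) {v : W} (hv : v ∈ cs.parabolic J) (x : W) :
    x * v ∈ C ↔ x ∈ C := by
  induction hv using Subgroup.closure_induction generalizing x with
  | mem _ hs =>
    obtain ⟨j, hj, rfl⟩ := hs
    exact ⟨fun hx => by simpa using h j hj _ hx, h j hj x⟩
  | one => rw [mul_one]
  | mul a b _ _ iha ihb => rw [← mul_assoc, ihb, iha]
  | inv a _ iha => rw [← iha, inv_mul_cancel_right]

/-- A parabolic double coset is presented, around any of its elements, by the sets of all simple
reflections which stabilize it from the left and from the right. -/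
theorem eq_doubleCoset_stabilizing {I J : Set B} {w x : W} {C : Set W}
    (hC : C = cs.doubleCoset I w J) (hx : x ∈ C) :
    C = cs.doubleCoset {i | ∀ y ∈ C, cs.simple i * y ∈ C} x
      {j | ∀ y ∈ C, y * cs.simple j ∈ C} := by
  apply Set.Subset.antisymm
  · subst hC
    refine (cs.doubleCoset_subset_of_mem hx).trans (cs.doubleCoset_mono ?_ ?_ x)
    · exact fun i hi y hy => cs.simple_mul_mem_doubleCoset hi hy
    · exact fun j hj y hy => cs.mul_simple_mem_doubleCoset hj hy
  · rintro _ ⟨u, hu, v, hv, rfl⟩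
    rw [cs.mul_mem_iff_of_mem_parabolic_right (fun _ hj => hj) hv,
      cs.mul_mem_iff_of_mem_parabolic (fun _ hi => hi) hu]
    exact hx

end CoxeterSystem

/-- For a parabolic double coset `C`, the sets `M_L(C)` and `M_R(C)` (unions of the left,
resp. right, index sets over all presentations of `C`) give the largest presentation
`C = W_{M_L(C)} w W_{M_R(C)}`, and they can be described as the sets of simple
reflections which stabilize `C` by left (resp. right) multiplication. -/
theorem maximal_presentation
    [Fintype B] {M : CoxeterMatrix B} (cs : CoxeterSystem M W)
    (C : Set W) (hC : ∃ (I : Set B) (w : W) (J : Set B), C = cs.doubleCoset I w J)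
    (ML MR : Set B)
    (hML : ML = {s : B | ∃ (I J : Set B) (w : W), C = cs.doubleCoset I w J ∧ s ∈ I})
    (hMR : MR = {s : B | ∃ (I J : Set B) (w : W), C = cs.doubleCoset I w J ∧ s ∈ J}) :
    ((∀ w ∈ C, C = cs.doubleCoset ML w MR) ∧
      (∀ (I J : Set B) (w' : W), C = cs.doubleCoset I w' J → I ⊆ ML ∧ J ⊆ MR)) ∧
    (ML = {s : B | ∀ x ∈ C, cs.simple s * x ∈ C} ∧
      MR = {s : B | ∀ x ∈ C, x * cs.simple s ∈ C}) := by
  obtain ⟨I, w, J, hIJ⟩ := hC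
  have hw : w ∈ C := hIJ ▸ cs.mem_doubleCoset_self I w J
  have hL : ML = {s : B | ∀ x ∈ C, cs.simple s * x ∈ C} := by
    subst hML
    refine Set.Subset.antisymm ?_ fun i hi =>
      ⟨_, _, w, cs.eq_doubleCoset_stabilizing hIJ hw, hi⟩
    rintro i ⟨I', J', w', rfl, hi⟩ x hx
    exact cs.simple_mul_mem_doubleCoset hi hx
  have hR : MR = {s : B | ∀ x ∈ C, x * cs.simple s ∈ C} := by
    subst hMR
    refine Set.Subset.antisymm ?_ fun j hj =>
      ⟨_, _, w, cs.eq_doubleCoset_stabilizing hIJ hw, hj⟩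
    rintro j ⟨I', J', w', rfl, hj⟩ x hx
    exact cs.mul_simple_mem_doubleCoset hj hx
  refine ⟨⟨fun x hx => ?_, fun I' J' w' h => ⟨fun i hi => ?_, fun j hj => ?_⟩⟩, hL, hR⟩
  · rw [hL, hR]
    exact cs.eq_doubleCoset_stabilizing hIJ hx
  · rw [hML]
    exact ⟨I', J', w', h, hi⟩
  · rw [hMR]
    exact ⟨I', J', w', h, hj⟩
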